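/- arXiv:2104.07247 — 2 statements merged into one kernel-verified Lean document; each statement's English description precedes it below -/
import Mathlib

section
/- Let N ≥ 2, let μ be the uniform probability measure on the unit sphere of ℂ^N (the unique probability measure on the sphere invariant under the unitary group U(N)), and fix a unit vector φ in ℂ^N. Then for every ε ∈ [0, 1], μ{ψ : |⟪φ, ψ⟫|² > ε} = (1 - ε)^(N-1), and consequently μ{ψ : |⟪φ, ψ⟫|² < ε} = 1 - (1 - ε)^(N-1) for ε ∈ (0, 1]. -/
open scoped InnerProductSpace
open MeasureTheory

lemma gaussian_complex {b : ℝ} (hb : 0 < b) :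
    ∫ z : ℂ, Real.exp (-b * ‖z‖ ^ 2) = Real.pi / b := by
  rw [GaussianFourier.integral_rexp_neg_mul_sq_norm hb]; simp

lemma gaussian_complex_integrable {b : ℝ} (hb : 0 < b) :
    Integrable fun z : ℂ ↦ Real.exp (-b * ‖z‖ ^ 2) := by
  apply Integrable.of_integral_ne_zero
  rw [gaussian_complex hb]; positivity

lemma lintegral_gaussian_pi (n : ℕ) {b : ℝ} (hb : 0 < b) :
    ∫⁻ x : Fin n → ℂ, ENNReal.ofReal (Real.exp (-b * ∑ i, ‖x i‖ ^ 2)) =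
      ENNReal.ofReal ((Real.pi / b) ^ n) := by
  have h (x : Fin n → ℂ) : Real.exp (-b * ∑ i, ‖x i‖ ^ 2) = ∏ i, Real.exp (-b * ‖x i‖ ^ 2) := by
    rw [Finset.mul_sum, Real.exp_sum]
  simp_rw [h]
  rw [volume_pi, ← ofReal_integral_eq_lintegral_ofReal
    (Integrable.fintype_prod fun _ ↦ gaussian_complex_integrable hb)
    (.of_forall fun x ↦ by positivity)]
  rw [← volume_pi, integral_fintype_prod_volume_eq_prod (fun _ (z : ℂ) ↦ Real.exp (-b * ‖z‖ ^ 2))]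
  simp only [gaussian_complex hb, Finset.prod_const, Finset.card_univ, Fintype.card_fin]

lemma integral_Ioi_mul_exp_neg_sq (a : ℝ) :
    ∫ r in Set.Ioi a, r * Real.exp (-r ^ 2) = Real.exp (-a ^ 2) / 2 := by
  have hint : Integrable fun r : ℝ ↦ r * Real.exp (-r ^ 2) := by
    simpa using integrable_mul_exp_neg_mul_sq (b := 1) one_pos
  have hd (r : ℝ) : HasDerivAt (fun r : ℝ ↦ -Real.exp (-r ^ 2) / 2) (r * Real.exp (-r ^ 2)) r := by
    convert! (((hasDerivAt_pow 2 r).neg.exp).neg.div_const 2) using 1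
    simp; ring
  have hl : Filter.Tendsto (fun r : ℝ ↦ -Real.exp (-r ^ 2) / 2) Filter.atTop (nhds 0) := by
    have h := (Real.tendsto_exp_neg_atTop_nhds_zero.comp
      (Filter.tendsto_pow_atTop (α := ℝ) two_ne_zero)).neg.div_const 2
    simpa [Function.comp_def] using h
  rw [integral_Ioi_of_hasDerivAt_of_tendsto' (fun r _ ↦ hd r) hint.integrableOn hl]
  ring

lemma lintegral_gaussian_complex_tail {t : ℝ} (ht : 0 ≤ t) :
    ∫⁻ z : ℂ, {z : ℂ | t < ‖z‖ ^ 2}.indicator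
      (fun z ↦ ENNReal.ofReal (Real.exp (-‖z‖ ^ 2))) z =
      ENNReal.ofReal (Real.pi * Real.exp (-t)) := by
  have hS : MeasurableSet {z : ℂ | t < ‖z‖ ^ 2} := measurableSet_lt (by fun_prop) (by fun_prop)
  have hint : Integrable fun z : ℂ ↦ Real.exp (-‖z‖ ^ 2) := by
    simpa using gaussian_complex_integrable one_pos
  rw [lintegral_indicator hS, ← ofReal_integral_eq_lintegral_ofReal hint.integrableOn
    (.of_forall fun x ↦ by positivity), ← integral_indicator hS]
  congr 1
  have h := integral_fun_norm_addHaar (volume : Measure ℂ)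
    ((Set.Ioi √t).indicator fun r ↦ Real.exp (-r ^ 2))
  have h2 : {z : ℂ | t < ‖z‖ ^ 2}.indicator (fun z ↦ Real.exp (-‖z‖ ^ 2)) =
      fun z : ℂ ↦ (Set.Ioi √t).indicator (fun r ↦ Real.exp (-r ^ 2)) ‖z‖ := by
    ext z
    simp [Set.indicator_apply, Real.sqrt_lt ht (norm_nonneg z)]
  have h3 : (fun y : ℝ ↦ y ^ (2 - 1) • (Set.Ioi √t).indicator (fun r ↦ Real.exp (-r ^ 2)) y) =
     (Set.Ioi √t).indicator (fun r ↦ r * Real.exp (-r ^ 2)) := by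
    ext y
    simp [Set.indicator_apply]
  rw [h2, h, Complex.finrank_real_complex, h3, setIntegral_indicator measurableSet_Ioi,
    Set.inter_eq_right.2 (Set.Ioi_subset_Ioi (Real.sqrt_nonneg t)), integral_Ioi_mul_exp_neg_sq,
    Real.sq_sqrt ht]
  simp [Measure.real]
  ring

lemma lintegral_gaussian_pi_cone (n : ℕ) {ε : ℝ} (h0 : 0 ≤ ε) (h1 : ε < 1) :
    ∫⁻ x : Fin (n + 1) → ℂ, {x : Fin (n + 1) → ℂ | ε * ∑ i, ‖x i‖ ^ 2 < ‖x 0‖ ^ 2}.indicator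
      (fun x ↦ ENNReal.ofReal (Real.exp (-∑ i, ‖x i‖ ^ 2))) x =
      ENNReal.ofReal (Real.pi ^ (n + 1) * (1 - ε) ^ n) := by
  have h1' : 0 < 1 - ε := sub_pos.2 h1
  set a := ε / (1 - ε) with ha
  have ha0 : 0 ≤ a := by positivity
  let e := MeasurableEquiv.piFinSuccAbove (fun _ : Fin (n + 1) ↦ ℂ) 0
  have he : MeasurePreserving e.symm volume volume :=
    (volume_preserving_piFinSuccAbove (fun _ : Fin (n + 1) ↦ ℂ) 0).symm
  have hm : Measurable ({x : Fin (n + 1) → ℂ | ε * ∑ i, ‖x i‖ ^ 2 < ‖x 0‖ ^ 2}.indicator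
      (fun x ↦ ENNReal.ofReal (Real.exp (-∑ i, ‖x i‖ ^ 2)))) :=
    Measurable.indicator (by fun_prop) (measurableSet_lt (by fun_prop) (by fun_prop))
  rw [← he.lintegral_comp hm, Measure.volume_eq_prod]
  refine (lintegral_prod_symm' _ (hm.comp e.symm.measurable)).trans ?_
  have key (y : Fin n → ℂ) (z : ℂ) :
      {x : Fin (n + 1) → ℂ | ε * ∑ i, ‖x i‖ ^ 2 < ‖x 0‖ ^ 2}.indicator
        (fun x ↦ ENNReal.ofReal (Real.exp (-∑ i, ‖x i‖ ^ 2))) (e.symm (z, y)) =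
      ENNReal.ofReal (Real.exp (-∑ i, ‖y i‖ ^ 2)) *
        {z : ℂ | a * ∑ i, ‖y i‖ ^ 2 < ‖z‖ ^ 2}.indicator
          (fun z ↦ ENNReal.ofReal (Real.exp (-‖z‖ ^ 2))) z := by
    have hez : e.symm (z, y) = Fin.cons z y := by
      simp [e, MeasurableEquiv.piFinSuccAbove, Fin.consEquiv]
    have hiff (T s : ℝ) : ε * (s + T) < s ↔ a * T < s := by
      rw [ha, div_mul_eq_mul_div, div_lt_iff₀ h1']
      constructor <;> intro h <;> linarith
    simp only [hez, Set.indicator_apply, Set.mem_ofPred_eq, Fin.sum_univ_succ, Fin.cons_zero,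
      Fin.cons_succ, hiff]
    split_ifs
    · rw [← ENNReal.ofReal_mul (by positivity), ← Real.exp_add]
      ring_nf
    · simp
  simp only [Function.comp_apply, key]
  have inner (y : Fin n → ℂ) : ∫⁻ z : ℂ, ENNReal.ofReal (Real.exp (-∑ i, ‖y i‖ ^ 2)) *
        {z : ℂ | a * ∑ i, ‖y i‖ ^ 2 < ‖z‖ ^ 2}.indicator
          (fun z ↦ ENNReal.ofReal (Real.exp (-‖z‖ ^ 2))) z =
      ENNReal.ofReal Real.pi * ENNReal.ofReal (Real.exp (-(1 + a) * ∑ i, ‖y i‖ ^ 2)) := by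
    rw [lintegral_const_mul' _ _ ENNReal.ofReal_ne_top,
      lintegral_gaussian_complex_tail (by positivity), ← ENNReal.ofReal_mul (by positivity),
      ← ENNReal.ofReal_mul (by positivity), mul_left_comm, ← Real.exp_add]
    ring_nf
  simp only [inner]
  rw [lintegral_const_mul' _ _ ENNReal.ofReal_ne_top, lintegral_gaussian_pi n (by positivity),
    ← ENNReal.ofReal_mul (by positivity)]
  have : 1 + a = (1 - ε)⁻¹ := by rw [ha]; field_simp; ring
  rw [this, div_inv_eq_mul, mul_pow]
  ring_nf

/-- Some unitary map sends a given unit vector to a given standard basis vector. -/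
lemma exists_linearIsometryEquiv_single {N : ℕ} (ψ : EuclideanSpace ℂ (Fin N)) (hψ : ‖ψ‖ = 1)
    (i : Fin N) : ∃ U : EuclideanSpace ℂ (Fin N) ≃ₗᵢ[ℂ] EuclideanSpace ℂ (Fin N),
      U ψ = EuclideanSpace.single i 1 := by
  have ho : Orthonormal ℂ (({i} : Set (Fin N)).domRestrict fun _ ↦ ψ) :=
    ⟨fun _ ↦ hψ, fun j k hjk ↦ (hjk (Subsingleton.elim j k)).elim⟩
  obtain ⟨b, hb⟩ := ho.exists_orthonormalBasis_extension_of_card_eq (by simp)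
  exact ⟨b.repr, by rw [← hb i rfl, b.repr_self]⟩

/-- Lebesgue measure on `ℂ^N`, transported from the product `Fin N → ℂ`. -/
noncomputable def euclideanLebesgue (N : ℕ) [MeasurableSpace (EuclideanSpace ℂ (Fin N))] :
    Measure (EuclideanSpace ℂ (Fin N)) :=
  Measure.map (WithLp.toLp 2) (volume : Measure (Fin N → ℂ))

section

variable {N : ℕ} [MeasurableSpace (EuclideanSpace ℂ (Fin N))]
  [BorelSpace (EuclideanSpace ℂ (Fin N))]

instance : (euclideanLebesgue N).IsAddHaarMeasure :=
  (PiLp.continuousLinearEquiv 2 ℝ (fun _ : Fin N ↦ ℂ)).symm.isAddHaarMeasure_map volume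

lemma lintegral_euclideanLebesgue {f : EuclideanSpace ℂ (Fin N) → ENNReal} (hf : Measurable f) :
    ∫⁻ x, f x ∂euclideanLebesgue N = ∫⁻ x : Fin N → ℂ, f (WithLp.toLp 2 x) :=
  lintegral_map hf (PiLp.continuous_toLp 2 _).measurable

lemma measurePreserving_euclideanLebesgue
    (U : EuclideanSpace ℂ (Fin N) ≃ₗᵢ[ℂ] EuclideanSpace ℂ (Fin N)) :
    MeasurePreserving U (euclideanLebesgue N) (euclideanLebesgue N) := by
  let _ : MeasureSpace (EuclideanSpace ℂ (Fin N)) := measureSpaceOfInnerProductSpace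
  let V : EuclideanSpace ℂ (Fin N) ≃ₗᵢ[ℝ] EuclideanSpace ℂ (Fin N) :=
    { U.toLinearEquiv.restrictScalars ℝ with norm_map' := U.norm_map }
  have hV : MeasurePreserving U volume volume := V.measurePreserving
  rw [Measure.isAddLeftInvariant_eq_smul (euclideanLebesgue N) volume]
  exact hV.smul_measure _

lemma lintegral_gaussian_euclideanLebesgue :
    ∫⁻ x, ENNReal.ofReal (Real.exp (-‖x‖ ^ 2)) ∂euclideanLebesgue N =
      ENNReal.ofReal (Real.pi ^ N) := by
  rw [lintegral_euclideanLebesgue (by fun_prop)]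
  simpa [EuclideanSpace.norm_sq_eq] using lintegral_gaussian_pi N one_pos

lemma measure_fidelity_gt_eq_single {μ : Measure (EuclideanSpace ℂ (Fin N))}
    (hinv : ∀ U : EuclideanSpace ℂ (Fin N) ≃ₗᵢ[ℂ] EuclideanSpace ℂ (Fin N),
      Measure.map U μ = μ)
    {φ : EuclideanSpace ℂ (Fin N)} (hφ : ‖φ‖ = 1) (i : Fin N) (ε : ℝ) :
    μ {ψ | ε < ‖⟪φ, ψ⟫_ℂ‖ ^ 2} =
      μ {ψ | ε < ‖⟪EuclideanSpace.single i (1 : ℂ), ψ⟫_ℂ‖ ^ 2} := by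
  obtain ⟨U, hU⟩ := exists_linearIsometryEquiv_single φ hφ i
  conv_rhs => rw [← hinv U, Measure.map_apply U.continuous.measurable
    (measurableSet_lt (by fun_prop) (by fun_prop)), ← hU]
  simp [Set.preimage]

end

section

variable {n : ℕ} [MeasurableSpace (EuclideanSpace ℂ (Fin (n + 1)))]
  [BorelSpace (EuclideanSpace ℂ (Fin (n + 1)))]

lemma lintegral_gaussian_cone {ψ : EuclideanSpace ℂ (Fin (n + 1))} (hψ : ‖ψ‖ = 1) {ε : ℝ}
    (h0 : 0 ≤ ε) (h1 : ε < 1) :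
    ∫⁻ x, {x | ε * ‖x‖ ^ 2 < ‖⟪x, ψ⟫_ℂ‖ ^ 2}.indicator
      (fun x ↦ ENNReal.ofReal (Real.exp (-‖x‖ ^ 2))) x ∂euclideanLebesgue (n + 1) =
      ENNReal.ofReal (Real.pi ^ (n + 1) * (1 - ε) ^ n) := by
  obtain ⟨U, hU⟩ := exists_linearIsometryEquiv_single ψ hψ 0
  have hm : Measurable ({x : EuclideanSpace ℂ (Fin (n + 1)) |
      ε * ‖x‖ ^ 2 < ‖⟪x, EuclideanSpace.single 0 (1 : ℂ)⟫_ℂ‖ ^ 2}.indicator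
      (fun x ↦ ENNReal.ofReal (Real.exp (-‖x‖ ^ 2)))) :=
    Measurable.indicator (by fun_prop) (measurableSet_lt (by fun_prop) (by fun_prop))
  calc
    _ = ∫⁻ x, {x : EuclideanSpace ℂ (Fin (n + 1)) |
          ε * ‖x‖ ^ 2 < ‖⟪x, EuclideanSpace.single 0 (1 : ℂ)⟫_ℂ‖ ^ 2}.indicator
          (fun x ↦ ENNReal.ofReal (Real.exp (-‖x‖ ^ 2))) (U x) ∂euclideanLebesgue (n + 1) := by
      simp [Set.indicator_apply, ← hU]
    _ = _ := by
      rw [(measurePreserving_euclideanLebesgue U).lintegral_comp hm,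
        lintegral_euclideanLebesgue hm, ← lintegral_gaussian_pi_cone n h0 h1]
      simp [Set.indicator_apply, EuclideanSpace.norm_sq_eq, EuclideanSpace.inner_single_right]

variable {μ : Measure (EuclideanSpace ℂ (Fin (n + 1)))} [IsProbabilityMeasure μ]

lemma measure_fidelity_gt
    (hsphere : ∀ᵐ ψ ∂μ, ‖ψ‖ = 1)
    (hinv : ∀ U : EuclideanSpace ℂ (Fin (n + 1)) ≃ₗᵢ[ℂ] EuclideanSpace ℂ (Fin (n + 1)),
      Measure.map U μ = μ)
    {φ : EuclideanSpace ℂ (Fin (n + 1))} (hφ : ‖φ‖ = 1) {ε : ℝ} (h0 : 0 ≤ ε) (h1 : ε < 1) :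
    μ {ψ | ε < ‖⟪φ, ψ⟫_ℂ‖ ^ 2} = ENNReal.ofReal ((1 - ε) ^ n) := by
  let F (x ψ : EuclideanSpace ℂ (Fin (n + 1))) : ENNReal :=
    {x | ε * ‖x‖ ^ 2 < ‖⟪x, ψ⟫_ℂ‖ ^ 2}.indicator
      (fun x ↦ ENNReal.ofReal (Real.exp (-‖x‖ ^ 2))) x
  have hF : Measurable (Function.uncurry F) := by
    have : Function.uncurry F = {p : EuclideanSpace ℂ (Fin (n + 1)) × EuclideanSpace ℂ (Fin (n + 1)) |
        ε * ‖p.1‖ ^ 2 < ‖⟪p.1, p.2⟫_ℂ‖ ^ 2}.indicator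
        (fun p ↦ ENNReal.ofReal (Real.exp (-‖p.1‖ ^ 2))) := by
      ext p; simp [F, Function.uncurry, Set.indicator_apply]
    rw [this]
    exact Measurable.indicator (by fun_prop) (measurableSet_lt (by fun_prop) (by fun_prop))
  have hinner (x : EuclideanSpace ℂ (Fin (n + 1))) (hx : x ≠ 0) : ∫⁻ ψ, F x ψ ∂μ =
      ENNReal.ofReal (Real.exp (-‖x‖ ^ 2)) * μ {ψ | ε < ‖⟪φ, ψ⟫_ℂ‖ ^ 2} := by
    have hx0 : 0 < ‖x‖ := norm_pos_iff.2 hx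
    have hu : ‖((‖x‖⁻¹ : ℝ) : ℂ) • x‖ = 1 := by simp [norm_smul, hx0.ne']
    have hFx : F x = {ψ | ε < ‖⟪((‖x‖⁻¹ : ℝ) : ℂ) • x, ψ⟫_ℂ‖ ^ 2}.indicator
        fun _ ↦ ENNReal.ofReal (Real.exp (-‖x‖ ^ 2)) := by
      ext ψ
      have : ‖⟪((‖x‖⁻¹ : ℝ) : ℂ) • x, ψ⟫_ℂ‖ ^ 2 = ‖⟪x, ψ⟫_ℂ‖ ^ 2 / ‖x‖ ^ 2 := by
        rw [inner_smul_left, norm_mul, mul_pow]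
        simp [div_eq_inv_mul]
      simp only [F, Set.indicator_apply, Set.mem_ofPred_eq, this, lt_div_iff₀ (pow_pos hx0 2)]
    rw [hFx, lintegral_indicator_const (measurableSet_lt (by fun_prop) (by fun_prop)),
      measure_fidelity_gt_eq_single hinv hu 0, measure_fidelity_gt_eq_single hinv hφ 0]
  have hswap := lintegral_lintegral_swap (μ := euclideanLebesgue (n + 1)) (ν := μ) hF.aemeasurable
  have hL : ∫⁻ x, ∫⁻ ψ, F x ψ ∂μ ∂euclideanLebesgue (n + 1) =
      ENNReal.ofReal (Real.pi ^ (n + 1)) * μ {ψ | ε < ‖⟪φ, ψ⟫_ℂ‖ ^ 2} := by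
    rw [← lintegral_gaussian_euclideanLebesgue, ← lintegral_mul_const _ (by fun_prop)]
    refine lintegral_congr_ae ?_
    filter_upwards [Measure.ae_ne (euclideanLebesgue (n + 1)) 0] with x hx using hinner x hx
  have hR : ∫⁻ ψ, ∫⁻ x, F x ψ ∂euclideanLebesgue (n + 1) ∂μ =
      ENNReal.ofReal (Real.pi ^ (n + 1)) * ENNReal.ofReal ((1 - ε) ^ n) := by
    rw [← ENNReal.ofReal_mul (by positivity)]
    calc
      _ = ∫⁻ _, ENNReal.ofReal (Real.pi ^ (n + 1) * (1 - ε) ^ n) ∂μ :=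
        lintegral_congr_ae (hsphere.mono fun ψ hψ ↦ lintegral_gaussian_cone hψ h0 h1)
      _ = _ := by simp
  rw [hL, hR] at hswap
  exact (ENNReal.mul_right_inj (by simp; positivity) ENNReal.ofReal_ne_top).1 hswap

lemma measure_fidelity_ge (hn : n ≠ 0)
    (hsphere : ∀ᵐ ψ ∂μ, ‖ψ‖ = 1)
    (hinv : ∀ U : EuclideanSpace ℂ (Fin (n + 1)) ≃ₗᵢ[ℂ] EuclideanSpace ℂ (Fin (n + 1)),
      Measure.map U μ = μ)
    {φ : EuclideanSpace ℂ (Fin (n + 1))} (hφ : ‖φ‖ = 1) {ε : ℝ} (h0 : 0 < ε) (h1 : ε ≤ 1) :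
    μ {ψ | ε ≤ ‖⟪φ, ψ⟫_ℂ‖ ^ 2} = ENNReal.ofReal ((1 - ε) ^ n) := by
  refine le_antisymm ?_ ?_
  · have hlim : Filter.Tendsto (fun δ : ℝ ↦ ENNReal.ofReal ((1 - δ) ^ n)) (nhdsWithin ε (Set.Iio ε))
        (nhds (ENNReal.ofReal ((1 - ε) ^ n))) :=
      ((ENNReal.continuous_ofReal.comp (by fun_prop)).tendsto ε).mono_left nhdsWithin_le_nhds
    refine ge_of_tendsto hlim ?_
    filter_upwards [Ioo_mem_nhdsLT h0] with δ hδ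
    rw [← measure_fidelity_gt hsphere hinv hφ hδ.1.le (hδ.2.trans_le h1)]
    exact measure_mono fun ψ hψ ↦ hδ.2.trans_le hψ
  · rcases h1.lt_or_eq with h1 | rfl
    · rw [← measure_fidelity_gt hsphere hinv hφ h0.le h1]
      exact measure_mono (Set.ofPred_subset_ofPred.2 fun _ ↦ le_of_lt)
    · simp [hn]

end

/-- for the uniform (unitarily invariant) probability measure on the unit
sphere of `ℂ^N` and a fixed unit vector `φ`,
`μ{ψ : |⟪φ,ψ⟫|² > ε} = (1-ε)^(N-1)` for `ε ∈ [0,1]`, and consequently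
`μ{ψ : |⟪φ,ψ⟫|² < ε} = 1 - (1-ε)^(N-1)` for `ε ∈ (0,1]`. -/
theorem stmt_4 (N : ℕ) (hN : 2 ≤ N)
    [MeasurableSpace (EuclideanSpace ℂ (Fin N))] [BorelSpace (EuclideanSpace ℂ (Fin N))]
    (μ : Measure (EuclideanSpace ℂ (Fin N))) [IsProbabilityMeasure μ]
    (hsphere : μ {ψ : EuclideanSpace ℂ (Fin N) | ‖ψ‖ = 1} = 1)
    (hinv : ∀ U : EuclideanSpace ℂ (Fin N) ≃ₗᵢ[ℂ] EuclideanSpace ℂ (Fin N),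
      Measure.map U μ = μ)
    (φ : EuclideanSpace ℂ (Fin N)) (hφ : ‖φ‖ = 1) :
    (∀ ε : ℝ, ε ∈ Set.Icc (0 : ℝ) 1 →
      μ {ψ : EuclideanSpace ℂ (Fin N) | ε < ‖⟪φ, ψ⟫_ℂ‖ ^ 2} =
        ENNReal.ofReal ((1 - ε) ^ (N - 1))) ∧
    (∀ ε : ℝ, ε ∈ Set.Ioc (0 : ℝ) 1 →
      μ {ψ : EuclideanSpace ℂ (Fin N) | ‖⟪φ, ψ⟫_ℂ‖ ^ 2 < ε} =
        ENNReal.ofReal (1 - (1 - ε) ^ (N - 1))) := by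
  obtain ⟨n, rfl⟩ : ∃ n, N = n + 1 := ⟨N - 1, by omega⟩
  have hn : n ≠ 0 := by omega
  have hsphere' : ∀ᵐ ψ ∂μ, ‖ψ‖ = 1 :=
    (prob_compl_eq_zero_iff (measurableSet_eq_fun (by fun_prop) (by fun_prop))).2 hsphere
  simp only [Nat.add_sub_cancel]
  refine ⟨fun ε hε ↦ ?_, fun ε hε ↦ ?_⟩
  · rcases hε.2.lt_or_eq with h1 | rfl
    · exact measure_fidelity_gt hsphere' hinv hφ hε.1 h1
    · refine le_antisymm ?_ (by simp [hn])
      rw [← measure_fidelity_ge hn hsphere' hinv hφ one_pos le_rfl]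
      exact measure_mono (Set.ofPred_subset_ofPred.2 fun _ ↦ le_of_lt)
  · have hc : {ψ : EuclideanSpace ℂ (Fin (n + 1)) | ‖⟪φ, ψ⟫_ℂ‖ ^ 2 < ε} =
        {ψ | ε ≤ ‖⟪φ, ψ⟫_ℂ‖ ^ 2}ᶜ := by
      ext; simp
    rw [hc, prob_compl_eq_one_sub (measurableSet_le (by fun_prop) (by fun_prop)),
      measure_fidelity_ge hn hsphere' hinv hφ hε.1 hε.2,
      ENNReal.ofReal_sub _ (pow_nonneg (sub_nonneg.2 hε.2) n), ENNReal.ofReal_one]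
end

section
/- Let N ≥ 2, let ε ∈ (0, 1), and let ρ_1, ..., ρ_m be positive semidefinite operators on ℂ^N, each with trace 1, with total rank r = Σ_j rank(ρ_j). Then there exists a finite set of unit vectors ψ_1, ..., ψ_K in ℂ^N with K ≥ ⌊(1 - ε)^(1-N) - r⌋ such that |⟪ψ_a, ψ_b⟫|² < ε for all a ≠ b, and ⟪ψ_a, ρ_j ψ_a⟫ < ε for all a and all j = 1, ..., m. -/
open scoped InnerProductSpace ComplexOrder

section

open MeasureTheory Set Module

theorem lintegral_gaussian_compl_ball (s : ℝ) (hs : 0 ≤ s) :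
    ∫⁻ a : ℂ, {a : ℂ | s ≤ ‖a‖ ^ 2}.indicator (fun a ↦ ENNReal.ofReal (Real.exp (-‖a‖ ^ 2))) a =
      ENNReal.ofReal (Real.pi * Real.exp (-s)) := by
  have hint : ∫ a : ℂ, (Ici √s).indicator (fun y : ℝ ↦ Real.exp (-y ^ 2)) ‖a‖ =
      Real.pi * Real.exp (-s) := by
    rw [integral_fun_norm_addHaar volume ((Ici √s).indicator (fun y : ℝ ↦ Real.exp (-y ^ 2)))]
    have htail : ∫ y in Ioi √s, y * Real.exp (-y ^ 2) = Real.exp (-s) / 2 := by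
      rw [integral_Ioi_of_hasDerivAt_of_nonneg' (g := fun y ↦ -(Real.exp (-y ^ 2) / 2)) (l := 0)]
      · simp [Real.sq_sqrt hs]
      · intro x _
        have h : HasDerivAt (fun y : ℝ ↦ -y ^ 2) (-(2 * x)) x := by
          simpa using (hasDerivAt_pow 2 x).fun_neg
        convert! (h.exp.div_const 2).fun_neg using 1
        ring
      · exact fun x hx ↦ mul_nonneg ((Real.sqrt_nonneg s).trans hx.le) (Real.exp_pos _).le
      · have h : Filter.Tendsto (fun y : ℝ ↦ Real.exp (-y ^ 2)) Filter.atTop (nhds 0) :=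
          Real.tendsto_exp_atBot.comp
            (Filter.tendsto_neg_atTop_atBot.comp (Filter.tendsto_pow_atTop two_ne_zero))
        simpa using (h.div_const 2).neg
    have hind : ∫ y in Ioi (0 : ℝ),
        y ^ (finrank ℝ ℂ - 1) • (Ici √s).indicator (fun y : ℝ ↦ Real.exp (-y ^ 2)) y =
          Real.exp (-s) / 2 := by
      rw [← htail, ← integral_Ici_eq_integral_Ioi, ← integral_Ici_eq_integral_Ioi,
        ← integral_indicator measurableSet_Ici, ← integral_indicator measurableSet_Ici]
      congr 1 with y
      by_cases hy : √s ≤ y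
      · have : 0 ≤ y := (Real.sqrt_nonneg s).trans hy
        simp [indicator, hy, this]
      · simp [indicator, hy]
    rw [hind]
    simp [Measure.real, Complex.volume_ball]
    ring
  rw [← hint, ofReal_integral_eq_lintegral_ofReal]
  · refine lintegral_congr fun a ↦ ?_
    by_cases ha : s ≤ ‖a‖ ^ 2
    · simp [indicator, ha, Real.sqrt_le_left]
    · simp [indicator, ha, Real.sqrt_le_iff]
  · exact .of_integral_ne_zero (by rw [hint]; positivity)
  · exact Filter.Eventually.of_forall fun a ↦ indicator_nonneg (fun _ _ ↦ (Real.exp_pos _).le) _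

attribute [local instance] InnerProductSpace.complexToReal

theorem lintegral_gaussian {W : Type*} [NormedAddCommGroup W] [InnerProductSpace ℂ W]
    [FiniteDimensional ℂ W] [MeasurableSpace W] [BorelSpace W] {b : ℝ} (hb : 0 < b) :
    ∫⁻ w : W, ENNReal.ofReal (Real.exp (-b * ‖w‖ ^ 2)) =
      ENNReal.ofReal ((Real.pi / b) ^ finrank ℂ W) := by
  have : FiniteDimensional ℝ W := FiniteDimensional.complexToReal W
  have hint : ∫ w : W, Real.exp (-b * ‖w‖ ^ 2) = (Real.pi / b) ^ finrank ℂ W := by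
    rw [GaussianFourier.integral_rexp_neg_mul_sq_norm hb, finrank_real_of_complex]
    simp
  rw [← hint, ofReal_integral_eq_lintegral_ofReal]
  · refine .of_integral_ne_zero (by rw [hint]; positivity)
  · exact Filter.Eventually.of_forall fun a ↦ (Real.exp_pos _).le

variable {E : Type*} [NormedAddCommGroup E] [InnerProductSpace ℂ E]

/-- The splitting `(a, w) ↦ a • ψ + w` of a complex inner product space along a unit vector `ψ`. -/
noncomputable def coordEquiv [FiniteDimensional ℂ E] (ψ : E) (hψ : ‖ψ‖ = 1) :
    (ℂ × (ℂ ∙ ψ)ᗮ) ≃L[ℂ] E :=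
  (LinearEquiv.ofBijective
    ((LinearMap.toSpanSingleton ℂ E ψ).coprod (ℂ ∙ ψ)ᗮ.subtype) (by
      have hψ0 : ψ ≠ 0 := norm_ne_zero_iff.1 (by simp [hψ])
      constructor
      · rw [← LinearMap.ker_eq_bot, LinearMap.ker_eq_bot']
        rintro ⟨a, w⟩ h
        have hw := Submodule.mem_orthogonal_singleton_iff_inner_right.1 w.2
        have ha : a = 0 := by
          simpa [inner_add_right, inner_smul_right, hψ, hw, hψ0] using congrArg (fun x ↦ ⟪ψ, x⟫_ℂ) h
        subst ha
        simpa using h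
      · intro z
        refine ⟨(⟪ψ, z⟫_ℂ, ⟨z - ⟪ψ, z⟫_ℂ • ψ, ?_⟩), ?_⟩
        · rw [Submodule.mem_orthogonal_singleton_iff_inner_right]
          simp [inner_sub_right, inner_smul_right, inner_self_eq_norm_sq_to_K, hψ]
        · simp)).toContinuousLinearEquiv

variable [FiniteDimensional ℂ E]

theorem coordEquiv_apply (ψ : E) (hψ : ‖ψ‖ = 1) (p : ℂ × (ℂ ∙ ψ)ᗮ) :
    coordEquiv ψ hψ p = p.1 • ψ + p.2 := rfl

theorem inner_coordEquiv (ψ : E) (hψ : ‖ψ‖ = 1) (p : ℂ × (ℂ ∙ ψ)ᗮ) :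
    ⟪ψ, coordEquiv ψ hψ p⟫_ℂ = p.1 := by
  have hw := Submodule.mem_orthogonal_singleton_iff_inner_right.1 p.2.2
  simp [coordEquiv_apply, inner_self_eq_norm_sq_to_K, hψ, hw]

theorem norm_sq_coordEquiv (ψ : E) (hψ : ‖ψ‖ = 1) (p : ℂ × (ℂ ∙ ψ)ᗮ) :
    ‖coordEquiv ψ hψ p‖ ^ 2 = ‖p.1‖ ^ 2 + ‖p.2‖ ^ 2 := by
  have hw := Submodule.mem_orthogonal_singleton_iff_inner_right.1 p.2.2
  have := norm_add_sq_eq_norm_sq_add_norm_sq_of_inner_eq_zero (𝕜 := ℂ) (p.1 • ψ) (p.2 : E)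
    (by simp [inner_smul_left, hw])
  rw [coordEquiv_apply, pow_two, this, norm_smul, hψ]
  simp [pow_two]

variable [MeasurableSpace E] [BorelSpace E]

/-- A cone of vectors whose overlap with a unit vector is at least `ε` carries the fraction
`(1 - ε) ^ (dim E - 1)` of the Gaussian measure. -/
theorem lintegral_gaussian_cone_s6 {ε : ℝ} (h0 : 0 ≤ ε) (h1 : ε < 1) (ψ : E) (hψ : ‖ψ‖ = 1) :
    ∫⁻ z in {z : E | ε * ‖z‖ ^ 2 ≤ ‖⟪ψ, z⟫_ℂ‖ ^ 2}, ENNReal.ofReal (Real.exp (-‖z‖ ^ 2)) =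
      ENNReal.ofReal ((1 - ε) ^ (finrank ℂ E - 1)) *
        ∫⁻ z : E, ENNReal.ofReal (Real.exp (-‖z‖ ^ 2)) := by
  have : FiniteDimensional ℝ E := FiniteDimensional.complexToReal E
  have : FiniteDimensional ℝ (ℂ ∙ ψ)ᗮ := FiniteDimensional.complexToReal _
  have hfin : finrank ℂ (ℂ ∙ ψ)ᗮ = finrank ℂ E - 1 := by
    have h := (ℂ ∙ ψ).finrank_add_finrank_orthogonal
    rw [finrank_span_singleton (norm_ne_zero_iff.1 (by simp [hψ]))] at h
    omega
  let L := coordEquiv ψ hψ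
  have hL : Measure.IsAddHaarMeasure
      (((volume : Measure ℂ).prod (volume : Measure (ℂ ∙ ψ)ᗮ)).map L) :=
    L.isAddHaarMeasure_map _
  obtain ⟨c, hmap⟩ : ∃ c : NNReal, 
      (volume : Measure E) = c • ((volume : Measure ℂ).prod (volume : Measure (ℂ ∙ ψ)ᗮ)).map L :=
    ⟨_, Measure.isAddLeftInvariant_eq_smul volume _⟩
  have key : ∀ t : ℝ, 0 ≤ t → t < 1 →
      ∫⁻ z in {z : E | t * ‖z‖ ^ 2 ≤ ‖⟪ψ, z⟫_ℂ‖ ^ 2}, ENNReal.ofReal (Real.exp (-‖z‖ ^ 2)) =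
        c * ENNReal.ofReal (Real.pi * (Real.pi * (1 - t)) ^ (finrank ℂ E - 1)) := by
    intro t ht0 ht1
    have hcone : MeasurableSet {z : E | t * ‖z‖ ^ 2 ≤ ‖⟪ψ, z⟫_ℂ‖ ^ 2} :=
      measurableSet_le (by fun_prop) (by fun_prop)
    have hmeas : Measurable fun z : E ↦ ENNReal.ofReal (Real.exp (-‖z‖ ^ 2)) := by fun_prop
    have hpos : 0 < 1 - t := by linarith
    rw [← lintegral_indicator hcone, hmap, lintegral_smul_measure, ENNReal.smul_def, smul_eq_mul,
      lintegral_map (hmeas.indicator hcone) L.continuous.measurable]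
    congr 1
    refine (lintegral_prod_symm _
      ((hmeas.indicator hcone).comp L.continuous.measurable).aemeasurable).trans ?_
    have hinner : ∀ w : (ℂ ∙ ψ)ᗮ, ∫⁻ a : ℂ, {z : E | t * ‖z‖ ^ 2 ≤ ‖⟪ψ, z⟫_ℂ‖ ^ 2}.indicator
        (fun z : E ↦ ENNReal.ofReal (Real.exp (-‖z‖ ^ 2))) (L (a, w)) =
        ENNReal.ofReal Real.pi * ENNReal.ofReal (Real.exp (-(1 - t)⁻¹ * ‖w‖ ^ 2)) := by
      intro w
      have hs := lintegral_gaussian_compl_ball (t / (1 - t) * ‖w‖ ^ 2) (by positivity)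
      calc _ = ∫⁻ a : ℂ, ENNReal.ofReal (Real.exp (-‖w‖ ^ 2)) *
            {a : ℂ | t / (1 - t) * ‖w‖ ^ 2 ≤ ‖a‖ ^ 2}.indicator
              (fun a ↦ ENNReal.ofReal (Real.exp (-‖a‖ ^ 2))) a := by
            refine lintegral_congr fun a ↦ ?_
            change indicator _ _ (coordEquiv ψ hψ (a, w)) = _
            have hiff : t * (‖a‖ ^ 2 + ‖w‖ ^ 2) ≤ ‖a‖ ^ 2 ↔
                t / (1 - t) * ‖w‖ ^ 2 ≤ ‖a‖ ^ 2 := by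
              rw [div_mul_eq_mul_div, div_le_iff₀ hpos]
              constructor <;> intro <;> linarith
            simp only [indicator, mem_ofPred_eq, norm_sq_coordEquiv, inner_coordEquiv, hiff]
            split_ifs
            · rw [← ENNReal.ofReal_mul (Real.exp_pos _).le, ← Real.exp_add]
              congr 2
              ring
            · simp
        _ = _ := by
            rw [lintegral_const_mul' _ _ ENNReal.ofReal_ne_top, hs,
              ← ENNReal.ofReal_mul (Real.exp_pos _).le, ← ENNReal.ofReal_mul Real.pi_pos.le,
              mul_left_comm, ← Real.exp_add]
            congr 3
            field_simp
            ring
    refine (lintegral_congr hinner).trans ?_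
    rw [lintegral_const_mul' _ _ ENNReal.ofReal_ne_top, lintegral_gaussian (inv_pos.2 hpos),
      ← ENNReal.ofReal_mul Real.pi_pos.le, hfin, div_inv_eq_mul]
  have htot := key 0 le_rfl one_pos
  simp only [zero_mul, sq_nonneg, ofPred_true, Measure.restrict_univ, sub_zero, mul_one] at htot
  rw [key ε h0 h1, htot, mul_left_comm, ← ENNReal.ofReal_mul (by bound)]
  congr 2
  rw [mul_pow]; ring

theorem exists_forall_norm_inner_sq_lt [Nontrivial E] {ι : Type*} [Fintype ι] {ε : ℝ}
    (h0 : 0 ≤ ε) (h1 : ε < 1)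
    (v : ι → E) (hv : ∀ i, ‖v i‖ = 1)
    (hcard : Fintype.card ι * (1 - ε) ^ (finrank ℂ E - 1) < 1) :
    ∃ φ : E, ‖φ‖ = 1 ∧ ∀ i, ‖⟪v i, φ⟫_ℂ‖ ^ 2 < ε := by
  have : FiniteDimensional ℝ E := FiniteDimensional.complexToReal E
  have hpow : 0 ≤ (1 - ε) ^ (finrank ℂ E - 1) := pow_nonneg (by linarith) _
  by_contra! hcon
  have hcover : (⋃ i ∈ Finset.univ, {z : E | ε * ‖z‖ ^ 2 ≤ ‖⟪v i, z⟫_ℂ‖ ^ 2}) =ᵐ[volume]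
      (univ : Set E) := by
    refine Filter.EventuallyEq.of_eq (eq_univ_of_forall fun z ↦ ?_)
    by_cases hz : z = 0
    · obtain ⟨u, hu⟩ := exists_norm_eq E zero_le_one
      obtain ⟨i, -⟩ := hcon u hu
      exact mem_iUnion₂.2 ⟨i, Finset.mem_univ i, by simp [hz]⟩
    have hz' : ‖z‖ ≠ 0 := norm_ne_zero_iff.2 hz
    obtain ⟨i, hi⟩ := hcon (((‖z‖⁻¹ : ℝ) : ℂ) • z) (by simp [norm_smul, hz'])
    refine mem_iUnion₂.2 ⟨i, Finset.mem_univ i, ?_⟩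
    rw [inner_smul_right, norm_mul, mul_pow] at hi
    simp only [Complex.norm_real, norm_inv, norm_norm, inv_pow] at hi
    rw [inv_mul_eq_div, le_div_iff₀ (by positivity)] at hi
    exact hi
  have htot : ∫⁻ z : E, ENNReal.ofReal (Real.exp (-‖z‖ ^ 2)) =
      ENNReal.ofReal (Real.pi ^ finrank ℂ E) := by
    simpa using lintegral_gaussian (W := E) one_pos
  have hle : ∫⁻ z : E, ENNReal.ofReal (Real.exp (-‖z‖ ^ 2)) ≤
      ENNReal.ofReal (Fintype.card ι * (1 - ε) ^ (finrank ℂ E - 1)) *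
        ∫⁻ z : E, ENNReal.ofReal (Real.exp (-‖z‖ ^ 2)) := by
    calc _ = ∫⁻ z in ⋃ i ∈ Finset.univ, {z : E | ε * ‖z‖ ^ 2 ≤ ‖⟪v i, z⟫_ℂ‖ ^ 2},
          ENNReal.ofReal (Real.exp (-‖z‖ ^ 2)) := by
          rw [setLIntegral_congr hcover, Measure.restrict_univ]
      _ ≤ ∑ i, ∫⁻ z in {z : E | ε * ‖z‖ ^ 2 ≤ ‖⟪v i, z⟫_ℂ‖ ^ 2},
          ENNReal.ofReal (Real.exp (-‖z‖ ^ 2)) := by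
          simpa [tsum_fintype] using lintegral_iUnion_le (μ := volume)
            (fun i ↦ {z : E | ε * ‖z‖ ^ 2 ≤ ‖⟪v i, z⟫_ℂ‖ ^ 2})
            (fun z : E ↦ ENNReal.ofReal (Real.exp (-‖z‖ ^ 2)))
      _ = _ := by
          simp_rw [lintegral_gaussian_cone_s6 h0 h1 _ (hv _)]
          rw [Finset.sum_const, Finset.card_univ, nsmul_eq_mul, ← mul_assoc,
            ENNReal.ofReal_mul (Nat.cast_nonneg _), ENNReal.ofReal_natCast]
  rw [htot, ← ENNReal.ofReal_mul (by positivity),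
    ENNReal.ofReal_le_ofReal_iff (by positivity)] at hle
  have : 0 < Real.pi ^ finrank ℂ E := by positivity
  nlinarith

theorem exists_pairwise_norm_inner_sq_lt [Nontrivial E] {ι : Type*} [Fintype ι] {ε : ℝ}
    (h0 : 0 ≤ ε) (h1 : ε < 1)
    (v : ι → E) (hv : ∀ i, ‖v i‖ = 1) (K : ℕ)
    (hK : ∀ k < K, ((Fintype.card ι + k : ℕ) : ℝ) * (1 - ε) ^ (finrank ℂ E - 1) < 1) :
    ∃ ψ : Fin K → E, (∀ a, ‖ψ a‖ = 1) ∧ (∀ a b, a ≠ b → ‖⟪ψ a, ψ b⟫_ℂ‖ ^ 2 < ε) ∧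
      ∀ i a, ‖⟪v i, ψ a⟫_ℂ‖ ^ 2 < ε := by
  induction K with
  | zero => exact ⟨Fin.elim0, by simp⟩
  | succ K ih =>
    obtain ⟨ψ, hψ, hpair, hvψ⟩ := ih fun k hk ↦ hK k (hk.trans K.lt_succ_self)
    obtain ⟨φ, hφ, hlt⟩ := exists_forall_norm_inner_sq_lt h0 h1 (Sum.elim v ψ)
      (Sum.forall.2 ⟨hv, hψ⟩) (by simpa using hK K K.lt_succ_self)
    rw [Sum.forall] at hlt
    refine ⟨Fin.cons φ ψ, ?_, ?_, ?_⟩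
    · simpa [Fin.forall_fin_succ] using ⟨hφ, hψ⟩
    · have hlt' : ∀ a, ‖⟪φ, ψ a⟫_ℂ‖ ^ 2 < ε := fun a ↦ by
        rw [norm_inner_symm]; exact hlt.2 a
      intro a b hab
      cases a using Fin.cases <;> cases b using Fin.cases
      · exact absurd rfl hab
      · simpa using hlt' _
      · simpa using hlt.2 _
      · simpa using hpair _ _ fun h ↦ hab (congrArg _ h)
    · intro i a
      cases a using Fin.cases
      · simpa using hlt.1 i
      · simpa using hvψ i _

theorem inner_toEuclideanLin_eq_sum {n : Type*} [Fintype n] [DecidableEq n] {A : Matrix n n ℂ}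
    (hA : A.IsHermitian) (x : EuclideanSpace ℂ n) :
    (⟪x, Matrix.toEuclideanLin A x⟫_ℂ).re =
      ∑ i, hA.eigenvalues i * ‖⟪hA.eigenvectorBasis i, x⟫_ℂ‖ ^ 2 := by
  have happ : ∀ i, Matrix.toEuclideanLin A (hA.eigenvectorBasis i) =
      (hA.eigenvalues i : ℂ) • hA.eigenvectorBasis i := by
    intro i
    ext j
    simpa using congrFun (hA.mulVec_eigenvectorBasis i) j
  have hsymm := Matrix.isSymmetric_toEuclideanLin_iff.2 hA
  rw [← hA.eigenvectorBasis.sum_inner_mul_inner, Complex.re_sum]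
  refine Finset.sum_congr rfl fun i _ ↦ ?_
  rw [← hsymm, happ, inner_smul_left, Complex.conj_ofReal, mul_left_comm, Complex.re_ofReal_mul,
    ← inner_conj_symm x, Complex.conj_mul']
  norm_cast

theorem Matrix.PosSemidef.inner_toEuclideanLin_lt {n : Type*} [Fintype n] [DecidableEq n]
    {A : Matrix n n ℂ} (hA : A.PosSemidef) (htr : A.trace = 1) {ε : ℝ} (x : EuclideanSpace ℂ n)
    (hx : ∀ i, hA.1.eigenvalues i ≠ 0 → ‖⟪hA.1.eigenvectorBasis i, x⟫_ℂ‖ ^ 2 < ε) :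
    (⟪x, Matrix.toEuclideanLin A x⟫_ℂ).re < ε := by
  have hsum : ∑ i, hA.1.eigenvalues i = 1 := by
    have h := hA.1.trace_eq_sum_eigenvalues
    rw [htr] at h
    simpa using (congrArg Complex.re h).symm
  obtain ⟨i₀, -, hi₀⟩ : ∃ i ∈ Finset.univ, hA.1.eigenvalues i ≠ 0 :=
    Finset.exists_ne_zero_of_sum_ne_zero (by simp [hsum])
  have hmul : ∀ i, hA.1.eigenvalues i ≠ 0 →
      hA.1.eigenvalues i * ‖⟪hA.1.eigenvectorBasis i, x⟫_ℂ‖ ^ 2 < hA.1.eigenvalues i * ε :=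
    fun i hi ↦ mul_lt_mul_of_pos_left (hx i hi) ((hA.eigenvalues_nonneg i).lt_of_ne' hi)
  calc _ = ∑ i, hA.1.eigenvalues i * ‖⟪hA.1.eigenvectorBasis i, x⟫_ℂ‖ ^ 2 :=
        inner_toEuclideanLin_eq_sum hA.1 x
    _ < ∑ i, hA.1.eigenvalues i * ε := by
        refine Finset.sum_lt_sum (fun i _ ↦ ?_) ⟨i₀, Finset.mem_univ _, hmul i₀ hi₀⟩
        by_cases hi : hA.1.eigenvalues i = 0
        · simp [hi]
        · exact (hmul i hi).le
    _ = ε := by rw [← Finset.sum_mul, hsum, one_mul]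

end

/-- given densities `ρ_1, …, ρ_m` on `ℂ^N` of total rank `r` and
`ε ∈ (0,1)`, there exist at least `⌊(1-ε)^(1-N) - r⌋` unit vectors with pairwise overlap
less than `ε`, each with fidelity less than `ε` with every `ρ_j`. -/
theorem stmt_6 (N : ℕ) (hN : 2 ≤ N) (ε : ℝ) (hε : ε ∈ Set.Ioo (0 : ℝ) 1)
    (m : ℕ) (ρ : Fin m → Matrix (Fin N) (Fin N) ℂ)
    (hρ : ∀ j, (ρ j).PosSemidef) (hρtr : ∀ j, (ρ j).trace = 1)
    (r : ℕ) (hr : r = ∑ j, (ρ j).rank) :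
    ∃ (K : ℕ) (ψ : Fin K → EuclideanSpace ℂ (Fin N)),
      ⌊(1 - ε) ^ ((1 : ℤ) - N) - r⌋ ≤ (K : ℤ) ∧
      (∀ a, ‖ψ a‖ = 1) ∧
      (∀ a b, a ≠ b → ‖⟪ψ a, ψ b⟫_ℂ‖ ^ 2 < ε) ∧
      (∀ a j, (⟪ψ a, Matrix.toEuclideanLin (ρ j) (ψ a)⟫_ℂ).re < ε) := by
  have : Nonempty (Fin N) := ⟨⟨0, by omega⟩⟩
  let v : (Σ j, {i // (hρ j).1.eigenvalues i ≠ 0}) → EuclideanSpace ℂ (Fin N) :=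
    fun p ↦ (hρ p.1).1.eigenvectorBasis p.2
  have hcard : Fintype.card (Σ j, {i // (hρ j).1.eigenvalues i ≠ 0}) = r := by
    rw [hr, Fintype.card_sigma]
    exact Finset.sum_congr rfl fun j _ ↦ (hρ j).1.rank_eq_card_non_zero_eigs.symm
  have hpos : 0 < (1 - ε) ^ (N - 1) := pow_pos (by linarith [hε.2]) _
  have hpow : (1 - ε) ^ ((1 : ℤ) - N) = ((1 - ε) ^ (N - 1))⁻¹ := by
    rw [← zpow_natCast, ← zpow_neg]
    congr 1
    omega
  obtain ⟨ψ, hψ, hpair, hvψ⟩ := exists_pairwise_norm_inner_sq_lt hε.1.le hε.2 v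
    (fun p ↦ (hρ p.1).1.eigenvectorBasis.norm_eq_one _)
    ⌊(1 - ε) ^ ((1 : ℤ) - N) - r⌋.toNat (by
      intro k hk
      have hk' : ((k + 1 : ℤ) : ℝ) ≤ (1 - ε) ^ ((1 : ℤ) - N) - r :=
        Int.le_floor.1 (by omega)
      rw [hpow] at hk'
      rw [hcard, finrank_euclideanSpace_fin, ← lt_inv_mul_iff₀' hpos, mul_one]
      push_cast at hk' ⊢
      linarith)
  exact ⟨_, ψ, Int.self_le_toNat _, hψ, hpair, fun a j ↦
    (hρ j).inner_toEuclideanLin_lt (hρtr j) _ fun i hi ↦ hvψ ⟨j, i, hi⟩ a⟩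
end
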